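/- In a co-Frobenius coquasitriangular Hopf algebra, α_a = β_a; that is, σ(h ⊗ a⁻¹) = σ(a ⊗ h) for all h ∈ H. -/

import Mathlib

open TensorProduct Coalgebra HopfAlgebra

variable {k H : Type*} [Field k] [Ring H] [HopfAlgebra k H]

/-- The antipode of `H`, as a linear map. -/
local notation "𝐒" => HopfAlgebra.antipode (R := k)

/-- Convolution product on the dual of `H`: `(conv f g) h = f h₁ * g h₂`. -/
noncomputable def conv (f g : H →ₗ[k] k) : H →ₗ[k] k :=
  (LinearMap.mul' k k) ∘ₗ (TensorProduct.map f g) ∘ₗ (Coalgebra.comul (R := k))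

/-- `h ↦ f h₁ • h₂`. -/
noncomputable def lT (f : H →ₗ[k] k) : H →ₗ[k] H :=
  (TensorProduct.lid k H).toLinearMap ∘ₗ (f.rTensor H) ∘ₗ (Coalgebra.comul (R := k))

/-- The Sweedler sum `h ↦ f h₁ • p h₃ • g h₂`. -/
noncomputable def sw3 (f : H →ₗ[k] k) (g : H →ₗ[k] H) (p : H →ₗ[k] k) : H →ₗ[k] H :=
  (TensorProduct.lid k H).toLinearMap
    ∘ₗ (TensorProduct.rid k (k ⊗[k] H)).toLinearMap
    ∘ₗ (TensorProduct.map (TensorProduct.map f g) p)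
    ∘ₗ ((Coalgebra.comul (R := k)).rTensor H)
    ∘ₗ (Coalgebra.comul (R := k))

/-- `χ(h) = α(h₂) • S⁻²(h₁)`, the generalized Nakayama automorphism. -/
noncomputable def chiMap (Sinv : H →ₗ[k] H) (f : H →ₗ[k] k) : H →ₗ[k] H :=
  (TensorProduct.rid k H).toLinearMap
    ∘ₗ (TensorProduct.map (Sinv ∘ₗ Sinv) f)
    ∘ₗ (Coalgebra.comul (R := k))

/-- `f(R¹) • R²` for `R = R¹ ⊗ R² ∈ H ⊗ H`. -/
noncomputable def lap (f : H →ₗ[k] k) : (H ⊗[k] H) →ₗ[k] H :=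
  (TensorProduct.lid k H).toLinearMap ∘ₗ (f.rTensor H)

/-- `f(R²) • R¹` for `R = R¹ ⊗ R² ∈ H ⊗ H`. -/
noncomputable def rap (f : H →ₗ[k] k) : (H ⊗[k] H) →ₗ[k] H :=
  (TensorProduct.rid k H).toLinearMap ∘ₗ (LinearMap.lTensor H f)

/-- The Drinfeld element `u = S(R²)R¹`. -/
noncomputable def uElt (Rm : H ⊗[k] H) : H :=
  (LinearMap.mul' k H)
    ((TensorProduct.comm k H H)
      ((LinearMap.lTensor H (HopfAlgebra.antipode (R := k))) Rm))

/-- Convolution product on the dual of `H ⊗ H`. -/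
noncomputable def conv2 (f g : (H ⊗[k] H) →ₗ[k] k) : (H ⊗[k] H) →ₗ[k] k :=
  (LinearMap.mul' k k) ∘ₗ (TensorProduct.map f g) ∘ₗ (Coalgebra.comul (R := k) (A := H ⊗[k] H))

/-- `(h ⊗ l) ↦ σ(h₂ ⊗ l₂) • (l₁ * h₁)`. -/
noncomputable def ac1 (σ : (H ⊗[k] H) →ₗ[k] k) : (H ⊗[k] H) →ₗ[k] H :=
  (TensorProduct.rid k H).toLinearMap
    ∘ₗ (TensorProduct.map ((LinearMap.mul' k H) ∘ₗ (TensorProduct.comm k H H).toLinearMap) σ)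
    ∘ₗ (TensorProduct.tensorTensorTensorComm k H H H H).toLinearMap
    ∘ₗ (TensorProduct.map (Coalgebra.comul (R := k)) (Coalgebra.comul (R := k)))

/-- `(h ⊗ l) ↦ σ(h₁ ⊗ l₁) • (h₂ * l₂)`. -/
noncomputable def ac2 (σ : (H ⊗[k] H) →ₗ[k] k) : (H ⊗[k] H) →ₗ[k] H :=
  (TensorProduct.lid k H).toLinearMap
    ∘ₗ (TensorProduct.map σ (LinearMap.mul' k H))
    ∘ₗ (TensorProduct.tensorTensorTensorComm k H H H H).toLinearMap
    ∘ₗ (TensorProduct.map (Coalgebra.comul (R := k)) (Coalgebra.comul (R := k)))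

/-- `(h ⊗ l) ↦ ρ(h₁ ⊗ l₁) * lam(h₂ * l₂) * τ(h₃ ⊗ l₃)`. -/
noncomputable def trip (lam : H →ₗ[k] k) (ρ τ : (H ⊗[k] H) →ₗ[k] k) : (H ⊗[k] H) →ₗ[k] k :=
  (LinearMap.mul' k k)
    ∘ₗ ((LinearMap.mul' k k).rTensor k)
    ∘ₗ (TensorProduct.map (TensorProduct.map ρ (lam ∘ₗ (LinearMap.mul' k H))) τ)
    ∘ₗ ((TensorProduct.tensorTensorTensorComm k H H H H).toLinearMap.rTensor (H ⊗[k] H))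
    ∘ₗ (TensorProduct.tensorTensorTensorComm k (H ⊗[k] H) H (H ⊗[k] H) H).toLinearMap
    ∘ₗ (TensorProduct.map
          (((Coalgebra.comul (R := k)).rTensor H) ∘ₗ (Coalgebra.comul (R := k)))
          (((Coalgebra.comul (R := k)).rTensor H) ∘ₗ (Coalgebra.comul (R := k))))

/-- `u(h) = σ(h₂ ⊗ S h₁)`. -/
noncomputable def uF (σ : (H ⊗[k] H) →ₗ[k] k) : H →ₗ[k] k :=
  σ ∘ₗ (TensorProduct.comm k H H).toLinearMap
    ∘ₗ ((HopfAlgebra.antipode (R := k)).rTensor H) ∘ₗ (Coalgebra.comul (R := k))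

/-- `v(h) = σ(h₁ ⊗ S h₂)`. -/
noncomputable def vF (σ : (H ⊗[k] H) →ₗ[k] k) : H →ₗ[k] k :=
  σ ∘ₗ (LinearMap.lTensor H (HopfAlgebra.antipode (R := k))) ∘ₗ (Coalgebra.comul (R := k))

/-- `u⁻¹(h) = σ(S²(h₂) ⊗ h₁)`. -/
noncomputable def uinvF (σ : (H ⊗[k] H) →ₗ[k] k) : H →ₗ[k] k :=
  σ ∘ₗ (((HopfAlgebra.antipode (R := k)) ∘ₗ (HopfAlgebra.antipode (R := k))).rTensor H)
    ∘ₗ (TensorProduct.comm k H H).toLinearMap ∘ₗ (Coalgebra.comul (R := k))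

/-- `v⁻¹(h) = σ(S²(h₁) ⊗ h₂)`. -/
noncomputable def vinvF (σ : (H ⊗[k] H) →ₗ[k] k) : H →ₗ[k] k :=
  σ ∘ₗ (((HopfAlgebra.antipode (R := k)) ∘ₗ (HopfAlgebra.antipode (R := k))).rTensor H)
    ∘ₗ (Coalgebra.comul (R := k))

open WithConv

/-- `h ↦ f h₂ • h₁`. -/
noncomputable def rT (f : H →ₗ[k] k) : H →ₗ[k] H :=
  (TensorProduct.rid k H).toLinearMap ∘ₗ (f.lTensor H) ∘ₗ (Coalgebra.comul (R := k))

lemma conv_apply_sum (f g : H →ₗ[k] k) (h : H) :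
    conv f g h = ∑ i ∈ (ℛ k h).index, f ((ℛ k h).left i) * g ((ℛ k h).right i) := by
  simp [conv, ← (ℛ k h).eq]

lemma lT_apply_sum (f : H →ₗ[k] k) (h : H) :
    lT f h = ∑ i ∈ (ℛ k h).index, f ((ℛ k h).left i) • (ℛ k h).right i := by
  simp [lT, ← (ℛ k h).eq]

lemma rT_apply_sum (f : H →ₗ[k] k) (h : H) :
    rT f h = ∑ i ∈ (ℛ k h).index, f ((ℛ k h).right i) • (ℛ k h).left i := by
  simp [rT, ← (ℛ k h).eq]

lemma conv_assoc (f g p : H →ₗ[k] k) : conv (conv f g) p = conv f (conv g p) :=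
  congrArg ofConv (mul_assoc (toConv f) (toConv g) (toConv p))

lemma conv_counit (f : H →ₗ[k] k) : conv f (Coalgebra.counit (R := k)) = f :=
  congrArg ofConv (mul_one (toConv f))

lemma counit_conv (f : H →ₗ[k] k) : conv (Coalgebra.counit (R := k)) f = f :=
  congrArg ofConv (one_mul (toConv f))

lemma counit_lT (f : H →ₗ[k] k) (h : H) : Coalgebra.counit (R := k) (lT f h) = f h := by
  conv_rhs => rw [← conv_counit f]
  simp [lT_apply_sum, conv_apply_sum]

lemma counit_rT (f : H →ₗ[k] k) (h : H) : Coalgebra.counit (R := k) (rT f h) = f h := by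
  conv_rhs => rw [← counit_conv f]
  simp [rT_apply_sum, conv_apply_sum, mul_comm]

lemma apply_lT (f g : H →ₗ[k] k) (h : H) : g (lT f h) = conv f g h := by
  simp [lT_apply_sum, conv_apply_sum]

lemma apply_rT (f g : H →ₗ[k] k) (h : H) : g (rT f h) = conv g f h := by
  simp [rT_apply_sum, conv_apply_sum, mul_comm]

lemma comul_lift_rT (Q : H →ₗ[k] H →ₗ[k] k) (h : H) :
    ∑ i ∈ (ℛ k h).index, rT (Q.flip ((ℛ k h).right i)) ((ℛ k h).left i) =
      rT (TensorProduct.lift Q ∘ₗ Coalgebra.comul) h := by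
  have key := congrArg (TensorProduct.rid k H ∘ (TensorProduct.lift Q).lTensor H)
    (sum_tmul_tmul_eq (ℛ k h) (fun i => ℛ k ((ℛ k h).left i)) (fun i => ℛ k ((ℛ k h).right i)))
  simp only [rT_apply_sum, LinearMap.comp_apply]
  simp only [← fun i => (ℛ k ((ℛ k h).right i)).eq]
  simpa [Finset.sum_smul] using key

lemma comul_lift_lT (Q : H →ₗ[k] H →ₗ[k] k) (h : H) :
    ∑ i ∈ (ℛ k h).index, lT (Q ((ℛ k h).left i)) ((ℛ k h).right i) =
      lT (TensorProduct.lift Q ∘ₗ Coalgebra.comul) h := by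
  have key := congrArg (TensorProduct.lid k H ∘ (TensorProduct.lift Q).rTensor H ∘
      (TensorProduct.assoc k H H H).symm)
    (sum_tmul_tmul_eq (ℛ k h) (fun i => ℛ k ((ℛ k h).left i)) (fun i => ℛ k ((ℛ k h).right i)))
  simp only [lT_apply_sum, LinearMap.comp_apply]
  simp only [← fun i => (ℛ k ((ℛ k h).left i)).eq]
  simpa [Finset.sum_smul] using key.symm

lemma comul_lift_conv (F : H →ₗ[k] H →ₗ[k] k) (g : H →ₗ[k] k) (h : H) :
    ∑ i ∈ (ℛ k h).index, conv (F ((ℛ k h).left i)) g ((ℛ k h).right i) =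
      conv (TensorProduct.lift F ∘ₗ Coalgebra.comul) g h := by
  have := congrArg g (comul_lift_lT F h)
  simpa [conv_apply_sum, lT_apply_sum] using this

section tensor

variable {B : Type*} [Ring B] [Algebra k B]

/-- `h ⊗ l ↦ ε(l) f(h)`. -/
noncomputable def onFst (f : H →ₗ[k] B) : (H ⊗[k] H) →ₗ[k] B :=
  (TensorProduct.rid k B).toLinearMap ∘ₗ TensorProduct.map f Coalgebra.counit

/-- `h ⊗ l ↦ ε(h) f(l)`. -/
noncomputable def onSnd (f : H →ₗ[k] B) : (H ⊗[k] H) →ₗ[k] B :=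
  (TensorProduct.lid k B).toLinearMap ∘ₗ TensorProduct.map Coalgebra.counit f

lemma sum_counit_smul' (h : H) :
    ∑ i ∈ (ℛ k h).index, Coalgebra.counit (R := k) ((ℛ k h).right i) • (ℛ k h).left i = h := by
  simpa only [map_sum, rid_tmul, one_smul]
    using congrArg (TensorProduct.rid k H) (sum_tmul_counit_eq (ℛ k h))

lemma onFst_mul_apply (f : H →ₗ[k] B) (g : (H ⊗[k] H) →ₗ[k] B) (h l : H) :
    (toConv (onFst f) * toConv g) (h ⊗ₜ l) =
      ∑ i ∈ (ℛ k h).index, f ((ℛ k h).left i) * g ((ℛ k h).right i ⊗ₜ l) := by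
  conv_rhs => rw [← sum_counit_smul (ℛ k l)]
  simp [((ℛ k h).tmul (ℛ k l)).convMul_apply, onFst, Finset.sum_product, tmul_sum,
    Finset.mul_sum]

lemma mul_onFst_apply (f : H →ₗ[k] B) (g : (H ⊗[k] H) →ₗ[k] B) (h l : H) :
    (toConv g * toConv (onFst f)) (h ⊗ₜ l) =
      ∑ i ∈ (ℛ k h).index, g ((ℛ k h).left i ⊗ₜ l) * f ((ℛ k h).right i) := by
  conv_rhs => rw [← sum_counit_smul' (k := k) l]
  simp [((ℛ k h).tmul (ℛ k l)).convMul_apply, onFst, Finset.sum_product, tmul_sum,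
    Finset.sum_mul]

lemma onSnd_mul_apply (f : H →ₗ[k] B) (g : (H ⊗[k] H) →ₗ[k] B) (h l : H) :
    (toConv (onSnd f) * toConv g) (h ⊗ₜ l) =
      ∑ i ∈ (ℛ k l).index, f ((ℛ k l).left i) * g (h ⊗ₜ (ℛ k l).right i) := by
  conv_rhs => rw [← sum_counit_smul (ℛ k h)]
  simp [((ℛ k h).tmul (ℛ k l)).convMul_apply, onSnd, Finset.sum_product_right, sum_tmul,
    Finset.mul_sum, ← smul_tmul']

lemma mul_onSnd_apply (f : H →ₗ[k] B) (g : (H ⊗[k] H) →ₗ[k] B) (h l : H) :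
    (toConv g * toConv (onSnd f)) (h ⊗ₜ l) =
      ∑ i ∈ (ℛ k l).index, g (h ⊗ₜ (ℛ k l).left i) * f ((ℛ k l).right i) := by
  conv_rhs => rw [← sum_counit_smul' (k := k) h]
  simp [((ℛ k h).tmul (ℛ k l)).convMul_apply, onSnd, Finset.sum_product_right, sum_tmul,
    Finset.sum_mul, ← smul_tmul']

end tensor

lemma eq_of_dual_apply_eq {x y : H} (h : ∀ f : H →ₗ[k] k, f x = f y) : x = y := by
  rw [← sub_eq_zero, ← Module.forall_dual_apply_eq_zero_iff k]
  intro f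
  rw [map_sub, h f, sub_self]

section integral

variable {lam : H →ₗ[k] k}

lemma rT_integral (hlam_int : ∀ f : H →ₗ[k] k, conv f lam = f 1 • lam) (h : H) :
    rT lam h = lam h • 1 :=
  eq_of_dual_apply_eq (k := k) fun f => by
    rw [apply_rT, hlam_int, LinearMap.smul_apply, map_smul, smul_eq_mul, smul_eq_mul, mul_comm]

lemma conv_integral_mulLeft (hlam_int : ∀ f : H →ₗ[k] k, conv f lam = f 1 • lam)
    (p : H →ₗ[k] k) (h l : H) :
    conv p (lam ∘ₗ LinearMap.mulLeft k h) l = lam (lT (p ∘ₗ 𝐒) h * l) := by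
  have hS : toConv (onFst (k := k) (H := H) 𝐒) * toConv (LinearMap.mul' k H) =
      toConv (onSnd (k := k) (H := H) LinearMap.id) := by
    ext h l
    change (toConv (onFst (k := k) (H := H) 𝐒) * toConv (LinearMap.mul' k H)) (h ⊗ₜ l) = _
    rw [onFst_mul_apply]
    simp [onSnd, ← mul_assoc, ← Finset.sum_mul, sum_antipode_mul_eq_smul]
  have hM : toConv (LinearMap.mul' k H) *
      toConv (Algebra.linearMap k H ∘ₗ lam ∘ₗ LinearMap.mul' k H) =
      toConv (Algebra.linearMap k H ∘ₗ lam ∘ₗ LinearMap.mul' k H) := by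
    ext h l
    have := rT_integral hlam_int (h * l)
    rw [rT, LinearMap.comp_apply, LinearMap.comp_apply, ← ((ℛ k h).mul (ℛ k l)).eq] at this
    simpa [((ℛ k h).tmul (ℛ k l)).convMul_apply, Algebra.algebraMap_eq_smul_one] using this
  have key : toConv (onSnd (k := k) (H := H) LinearMap.id) *
      toConv (Algebra.linearMap k H ∘ₗ lam ∘ₗ LinearMap.mul' k H) =
      toConv (onFst (k := k) (H := H) 𝐒) *
        toConv (Algebra.linearMap k H ∘ₗ lam ∘ₗ LinearMap.mul' k H) := by
    rw [← hS, mul_assoc, hM]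
  have key' := congrArg p (congrArg (fun F => F (h ⊗ₜ l)) key)
  simp only [onSnd_mul_apply, onFst_mul_apply] at key'
  simpa [conv_apply_sum, lT_apply_sum, Finset.sum_mul, Algebra.algebraMap_eq_smul_one,
    mul_comm] using key'

lemma conv_integral_mulRight {g : H} (hg : ∀ h : H, lT lam h = lam h • g)
    (p : H →ₗ[k] k) (h l : H) :
    conv (lam ∘ₗ LinearMap.mulRight k h) p l =
      lam (l * rT (p ∘ₗ LinearMap.mulLeft k g ∘ₗ 𝐒) h) := by
  set mulOp : (H ⊗[k] H) →ₗ[k] H :=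
    LinearMap.mul' k H ∘ₗ (TensorProduct.comm k H H).toLinearMap with hmulOp
  have hS : toConv mulOp * toConv (onFst (k := k) (H := H) 𝐒) =
      toConv (onSnd (k := k) (H := H) LinearMap.id) := by
    ext h l
    change (toConv mulOp * toConv (onFst (k := k) (H := H) 𝐒)) (h ⊗ₜ l) = _
    rw [mul_onFst_apply]
    simp [hmulOp, onSnd, mul_assoc, ← Finset.mul_sum, sum_mul_antipode_eq_smul]
  have hM : toConv (Algebra.linearMap k H ∘ₗ lam ∘ₗ mulOp) * toConv mulOp =
      toConv (LinearMap.mulRight k g ∘ₗ Algebra.linearMap k H ∘ₗ lam ∘ₗ mulOp) := by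
    ext h l
    have := hg (l * h)
    rw [lT, LinearMap.comp_apply, LinearMap.comp_apply, ← ((ℛ k l).mul (ℛ k h)).eq] at this
    simpa [hmulOp, ((ℛ k h).tmul (ℛ k l)).convMul_apply, Algebra.algebraMap_eq_smul_one,
      Finset.sum_product_right, Finset.sum_product (ℛ k l).index] using this
  have key : toConv (Algebra.linearMap k H ∘ₗ lam ∘ₗ mulOp) *
        toConv (onSnd (k := k) (H := H) LinearMap.id) =
      toConv (LinearMap.mulRight k g ∘ₗ Algebra.linearMap k H ∘ₗ lam ∘ₗ mulOp) *
        toConv (onFst (k := k) (H := H) 𝐒) := by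
    rw [← hS, ← mul_assoc, hM]
  have key' := congrArg p (congrArg (fun F => F (h ⊗ₜ l)) key)
  simp only [mul_onSnd_apply, mul_onFst_apply] at key'
  simpa [hmulOp, conv_apply_sum, rT_apply_sum, Finset.mul_sum, Algebra.algebraMap_eq_smul_one,
    mul_comm] using key'

lemma counit_eq_zero_of_integral_mul_eq_zero (hlam_ne : lam ≠ 0) {g : H}
    (hg : ∀ h : H, lT lam h = lam h • g) {x : H} (hx : ∀ l : H, lam (x * l) = 0) :
    Coalgebra.counit (R := k) x = 0 := by
  have hrT (p : H →ₗ[k] k) (l : H) : lam (rT p x * l) = 0 := by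
    have := conv_integral_mulRight hg p l x
    rw [hx] at this
    simpa [conv_apply_sum, rT_apply_sum, Finset.sum_mul, mul_comm] using this
  obtain ⟨m, hm⟩ := DFunLike.ne_iff.mp hlam_ne
  let b := Module.Basis.ofVectorSpace k H
  obtain ⟨c, hc⟩ := TensorProduct.eq_repr_basis_right b (Coalgebra.comul (R := k) x)
  classical
  have hcoord j : rT (b.coord j) x = c j := by
    rw [rT, LinearMap.comp_apply, LinearMap.comp_apply, ← hc]
    simp [Finsupp.sum, Finsupp.single_apply]
    exact fun h => h.symm
  have h0 : lam (LinearMap.mul' k H (LinearMap.lTensor H 𝐒 (Coalgebra.comul x)) * m) = 0 := by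
    rw [← hc]
    simp [Finsupp.sum, Finset.sum_mul, mul_assoc, ← hcoord, hrT]
  rw [mul_antipode_lTensor_comul_apply] at h0
  have hm : lam m ≠ 0 := hm
  simpa [Algebra.algebraMap_eq_smul_one, hm] using h0

end integral

section antipode

variable {Sinv : H →ₗ[k] H}

lemma sum_antipodeInv_mul (hl : ∀ h : H, Sinv (𝐒 h) = h) (hr : ∀ h : H, 𝐒 (Sinv h) = h) (h : H) :
    ∑ i ∈ (ℛ k h).index, Sinv ((ℛ k h).right i) * (ℛ k h).left i =
      Coalgebra.counit (R := k) h • 1 := by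
  apply Function.LeftInverse.injective hl
  simp [antipode_mul_antidistrib, hr, sum_antipode_mul_eq_smul]

lemma counit_antipodeInv (hr : ∀ h : H, 𝐒 (Sinv h) = h) (h : H) :
    Coalgebra.counit (R := k) (Sinv h) = Coalgebra.counit (R := k) h := by
  rw [← counit_antipode (R := k) (Sinv h), hr]

lemma counit_chiMap (hr : ∀ h : H, 𝐒 (Sinv h) = h) (f : H →ₗ[k] k) (h : H) :
    Coalgebra.counit (R := k) (chiMap Sinv f h) = f h := by
  conv_rhs => rw [← counit_conv f]
  simp [chiMap, conv_apply_sum, ← (ℛ k h).eq, counit_antipodeInv hr, mul_comm]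

lemma algHom_antipode_antipode (α : H →ₐ[k] k) (h : H) : α (𝐒 (𝐒 h)) = α h := by
  have h1 : toConv α.toLinearMap * toConv (α.toLinearMap ∘ₗ 𝐒) = 1 := by
    ext h
    have := congrArg α (sum_mul_antipode_eq_smul (ℛ k h))
    simpa [(ℛ k h).convMul_apply] using this
  have h2 : toConv (α.toLinearMap ∘ₗ 𝐒) * toConv (α.toLinearMap ∘ₗ 𝐒 ∘ₗ 𝐒) = 1 := by
    ext h
    have := congrArg (fun x => α (𝐒 x)) (sum_mul_antipode_eq_smul (ℛ k h))
    simpa [(ℛ k h).convMul_apply, antipode_mul_antidistrib, mul_comm] using this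
  exact congrArg (fun F => F h) (left_inv_eq_right_inv h1 h2).symm

end antipode

section coquasitriangular

variable {σ : (H ⊗[k] H) →ₗ[k] k}

lemma sigma_antipode_antipode {Sinv : H →ₗ[k] H}
    (hSinv_l : ∀ h : H, Sinv (𝐒 h) = h) (hSinv_r : ∀ h : H, 𝐒 (Sinv h) = h)
    (hσ1 : ∀ h l m : H, σ ((h * l) ⊗ₜ[k] m) =
      conv (σ ∘ₗ (TensorProduct.mk k H H h)) (σ ∘ₗ (TensorProduct.mk k H H l)) m)
    (hσ2 : ∀ h l m : H, σ (h ⊗ₜ[k] (l * m)) =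
      conv (σ ∘ₗ ((TensorProduct.mk k H H).flip m)) (σ ∘ₗ ((TensorProduct.mk k H H).flip l)) h)
    (hσ3l : ∀ h : H, σ (h ⊗ₜ[k] (1 : H)) = Coalgebra.counit (R := k) h)
    (hσ3r : ∀ h : H, σ ((1 : H) ⊗ₜ[k] h) = Coalgebra.counit (R := k) h) (h l : H) :
    σ (Sinv h ⊗ₜ l) = σ (h ⊗ₜ 𝐒 l) := by
  have hL : toConv (σ ∘ₗ LinearMap.rTensor H 𝐒) * toConv σ = 1 := by
    ext h l
    have := congrArg (fun x => σ (x ⊗ₜ l)) (sum_antipode_mul_eq_smul (ℛ k h))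
    simpa [((ℛ k h).tmul (ℛ k l)).convMul_apply, Finset.sum_product, sum_tmul, hσ1, hσ3r,
      conv_apply_sum, ← smul_tmul', mul_comm] using this
  have hR : toConv σ * toConv (σ ∘ₗ LinearMap.lTensor H Sinv) = 1 := by
    ext h l
    have := congrArg (fun x => σ (h ⊗ₜ x)) (sum_antipodeInv_mul hSinv_l hSinv_r l)
    simpa [((ℛ k h).tmul (ℛ k l)).convMul_apply, Finset.sum_product_right, tmul_sum, hσ2, hσ3l,
      conv_apply_sum, mul_comm] using this
  have := congrArg (fun F => F (Sinv h ⊗ₜ 𝐒 l)) (left_inv_eq_right_inv hL hR)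
  simpa [hSinv_l, hSinv_r] using this.symm

lemma sigma_integral_comm (lam : H →ₗ[k] k)
    (hσ4 : ∀ h l : H, ac1 σ (h ⊗ₜ[k] l) = ac2 σ (h ⊗ₜ[k] l)) (h l : H) :
    ∑ i ∈ (ℛ k h).index, ∑ j ∈ (ℛ k l).index,
        lam ((ℛ k l).left j * (ℛ k h).left i) * σ ((ℛ k h).right i ⊗ₜ (ℛ k l).right j) =
      ∑ i ∈ (ℛ k h).index, ∑ j ∈ (ℛ k l).index,
        σ ((ℛ k h).left i ⊗ₜ (ℛ k l).left j) * lam ((ℛ k h).right i * (ℛ k l).right j) := by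
  have := congrArg lam (hσ4 h l)
  simp only [ac1, ac2, LinearMap.comp_apply, TensorProduct.map_tmul, ← (ℛ k h).eq,
    ← (ℛ k l).eq] at this
  rw [Finset.sum_comm, Finset.sum_comm (s := (ℛ k h).index) (t := (ℛ k l).index)]
  simpa [sum_tmul, tmul_sum, mul_comm] using this

lemma integral_lT_vF {lam : H →ₗ[k] k} {g : H}
    (hlam_int : ∀ f : H →ₗ[k] k, conv f lam = f 1 • lam)
    (hg : ∀ h : H, lT lam h = lam h • g)
    (hσ2 : ∀ h l m : H, σ (h ⊗ₜ[k] (l * m)) =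
      conv (σ ∘ₗ ((TensorProduct.mk k H H).flip m)) (σ ∘ₗ ((TensorProduct.mk k H H).flip l)) h)
    (hσ4 : ∀ h l : H, ac1 σ (h ⊗ₜ[k] l) = ac2 σ (h ⊗ₜ[k] l)) (h l : H) :
    lam (lT (vF σ) h * l) =
      lam (l * rT (conv (uF σ) (σ ∘ₗ (TensorProduct.mk k H H).flip g)) h) := by
  let σ' : H →ₗ[k] H →ₗ[k] k := TensorProduct.curry σ
  have hv : vF σ = TensorProduct.lift (σ'.compl₂ 𝐒) ∘ₗ Coalgebra.comul := by
    ext h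
    simp [vF, σ', ← (ℛ k h).eq]
  have hu : uF σ = TensorProduct.lift (σ'.flip ∘ₗ 𝐒) ∘ₗ Coalgebra.comul := by
    ext h
    simp [uF, σ', ← (ℛ k h).eq]
  have hw : conv (uF σ) (σ ∘ₗ (TensorProduct.mk k H H).flip g) =
      TensorProduct.lift (σ'.compl₂ (LinearMap.mulLeft k g ∘ₗ 𝐒)).flip ∘ₗ Coalgebra.comul := by
    ext h
    rw [hu, ← comul_lift_conv, LinearMap.comp_apply, ← (ℛ k h).eq]
    simp only [map_sum, TensorProduct.lift.tmul]
    exact Finset.sum_congr rfl fun i _ => (hσ2 _ _ _).symm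
  rw [hw, ← comul_lift_rT, hv, ← comul_lift_lT, Finset.sum_mul, Finset.mul_sum, map_sum, map_sum]
  have hleft i : lam (lT (σ'.compl₂ 𝐒 ((ℛ k h).left i)) ((ℛ k h).right i) * l) = _ :=
    (conv_integral_mulLeft hlam_int (σ' ((ℛ k h).left i)) ((ℛ k h).right i) l).symm
  have hright i : lam (l * rT ((σ'.compl₂ (LinearMap.mulLeft k g ∘ₗ 𝐒)).flip.flip
      ((ℛ k h).right i)) ((ℛ k h).left i)) = _ :=
    (conv_integral_mulRight hg (σ' ((ℛ k h).right i)) ((ℛ k h).left i) l).symm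
  simp only [hleft, hright, conv_apply_sum]
  exact (sigma_integral_comm lam hσ4 h l).symm

lemma integral_lT_uF {lam : H →ₗ[k] k} {g g' : H} {Sinv : H →ₗ[k] H}
    (hlam_int : ∀ f : H →ₗ[k] k, conv f lam = f 1 • lam)
    (hg : ∀ h : H, lT lam h = lam h • g) (hg' : 𝐒 g' = g) (hgg' : g' * g = 1)
    (hSinv_l : ∀ h : H, Sinv (𝐒 h) = h)
    (hσ1 : ∀ h l m : H, σ ((h * l) ⊗ₜ[k] m) =
      conv (σ ∘ₗ (TensorProduct.mk k H H h)) (σ ∘ₗ (TensorProduct.mk k H H l)) m)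
    (hσS : ∀ h l : H, σ (Sinv h ⊗ₜ l) = σ (h ⊗ₜ 𝐒 l))
    (hσ4 : ∀ h l : H, ac1 σ (h ⊗ₜ[k] l) = ac2 σ (h ⊗ₜ[k] l)) (h l : H) :
    lam (h * lT (uF σ) l) =
      lam (rT (conv (vF σ) (σ ∘ₗ TensorProduct.mk k H H g)) l * h) := by
  let σ' : H →ₗ[k] H →ₗ[k] k := TensorProduct.curry σ
  have hv : vF σ = TensorProduct.lift (σ' ∘ₗ Sinv) ∘ₗ Coalgebra.comul := by
    ext h
    simp [vF, σ', ← (ℛ k h).eq, hσS]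
  have hu : uF σ = TensorProduct.lift (σ' ∘ₗ Sinv).flip ∘ₗ Coalgebra.comul := by
    ext h
    simp [uF, σ', ← (ℛ k h).eq, hσS]
  have hw : conv (vF σ) (σ ∘ₗ TensorProduct.mk k H H g) =
      TensorProduct.lift (σ' ∘ₗ LinearMap.mulRight k g ∘ₗ Sinv) ∘ₗ Coalgebra.comul := by
    ext h
    rw [hv, ← comul_lift_conv, LinearMap.comp_apply, ← (ℛ k h).eq]
    simp only [map_sum, TensorProduct.lift.tmul]
    exact Finset.sum_congr rfl fun i _ => (hσ1 _ _ _).symm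
  have hL (p : H →ₗ[k] k) (x y : H) :
      lam (x * lT (p ∘ₗ Sinv) y) = conv p (lam ∘ₗ LinearMap.mulRight k y) x := by
    have := conv_integral_mulLeft hlam_int (p ∘ₗ Sinv) x y
    rw [LinearMap.comp_assoc, show Sinv ∘ₗ 𝐒 = LinearMap.id from LinearMap.ext hSinv_l,
      LinearMap.comp_id] at this
    simpa [conv_apply_sum, lT_apply_sum, Finset.sum_mul, Finset.mul_sum] using this
  have hR (p : H →ₗ[k] k) (x y : H) :
      lam (rT (p ∘ₗ LinearMap.mulRight k g ∘ₗ Sinv) x * y) =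
        conv (lam ∘ₗ LinearMap.mulLeft k x) p y := by
    have := conv_integral_mulRight hg (p ∘ₗ LinearMap.mulRight k g ∘ₗ Sinv) y x
    rw [show (p ∘ₗ LinearMap.mulRight k g ∘ₗ Sinv) ∘ₗ LinearMap.mulLeft k g ∘ₗ 𝐒 = p by
      ext z
      simp [← hg', ← antipode_mul_antidistrib, hSinv_l, mul_assoc]
      simp [hg', hgg']] at this
    simpa [conv_apply_sum, rT_apply_sum, Finset.sum_mul, Finset.mul_sum, mul_comm] using this
  rw [hw, ← comul_lift_rT, hu, ← comul_lift_lT, Finset.sum_mul, Finset.mul_sum, map_sum, map_sum]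
  have hleft j : lam (h * lT ((σ' ∘ₗ Sinv).flip ((ℛ k l).left j)) ((ℛ k l).right j)) = _ :=
    hL (σ'.flip ((ℛ k l).left j)) h ((ℛ k l).right j)
  have hright j : lam (rT ((σ' ∘ₗ LinearMap.mulRight k g ∘ₗ Sinv).flip
      ((ℛ k l).right j)) ((ℛ k l).left j) * h) = _ :=
    hR (σ'.flip ((ℛ k l).right j)) ((ℛ k l).left j) h
  simp only [hleft, hright, conv_apply_sum]
  rw [Finset.sum_comm, Finset.sum_comm (s := (ℛ k l).index)]
  exact (sigma_integral_comm lam hσ4 h l).symm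

lemma algHom_conv_uF_comm (α : H →ₐ[k] k)
    (huinv_l : conv (uinvF σ) (uF σ) = Coalgebra.counit (R := k))
    (hS2u : ∀ h : H, 𝐒 (𝐒 h) = sw3 (uF σ) LinearMap.id (uinvF σ) h) :
    conv (uF σ) α.toLinearMap = conv α.toLinearMap (uF σ) := by
  have h1 : conv (conv (uF σ) α.toLinearMap) (uinvF σ) = α.toLinearMap := by
    ext h
    have := congrArg α (hS2u h)
    rw [algHom_antipode_antipode] at this
    rw [AlgHom.toLinearMap_apply, this, sw3]
    simp only [LinearMap.comp_apply, conv_apply_sum, ← (ℛ k h).eq]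
    simp [← fun i => (ℛ k ((ℛ k h).left i)).eq, Finset.mul_sum,
      sum_tmul, mul_comm, mul_left_comm]
  rw [← conv_counit (conv _ _), ← huinv_l, ← conv_assoc, h1]

end coquasitriangular

/-- In a co-Frobenius coquasitriangular Hopf algebra, $α_a = β_a$:
$σ(h ⊗ a^{-1}) = σ(a ⊗ h)$ for all $h$. -/
theorem alpha_a_eq_beta_a
    (lam : H →ₗ[k] k) (hlam_ne : lam ≠ 0)
    (hlam_int : ∀ f : H →ₗ[k] k, conv f lam = f 1 • lam)
    (a : H) (ha_ne : a ≠ 0) (ha_grp : Coalgebra.comul (R := k) a = a ⊗ₜ[k] a)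
    (ha_mod : ∀ h : H, lT lam h = lam h • (𝐒 a))
    (ha_S2 : ∀ h : H, lam (𝐒 (𝐒 h)) = lam (a * h * 𝐒 a))
    (Sinv : H →ₗ[k] H) (hSinv_l : ∀ h : H, Sinv (𝐒 h) = h)
    (hSinv_r : ∀ h : H, 𝐒 (Sinv h) = h)
    (α : H →ₐ[k] k)
    (hα : ∀ h l : H, lam (l * h) = lam ((chiMap Sinv α.toLinearMap h) * l))
    (σ : (H ⊗[k] H) →ₗ[k] k)
    (hσ1 : ∀ h l m : H, σ ((h * l) ⊗ₜ[k] m) =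
      conv (σ ∘ₗ (TensorProduct.mk k H H h)) (σ ∘ₗ (TensorProduct.mk k H H l)) m)
    (hσ2 : ∀ h l m : H, σ (h ⊗ₜ[k] (l * m)) =
      conv (σ ∘ₗ ((TensorProduct.mk k H H).flip m)) (σ ∘ₗ ((TensorProduct.mk k H H).flip l)) h)
    (hσ3l : ∀ h : H, σ (h ⊗ₜ[k] (1 : H)) = Coalgebra.counit (R := k) h)
    (hσ3r : ∀ h : H, σ ((1 : H) ⊗ₜ[k] h) = Coalgebra.counit (R := k) h)
    (hσ4 : ∀ h l : H, ac1 σ (h ⊗ₜ[k] l) = ac2 σ (h ⊗ₜ[k] l))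
    (huinv_r : conv (uF σ) (uinvF σ) = Coalgebra.counit (R := k))
    (huinv_l : conv (uinvF σ) (uF σ) = Coalgebra.counit (R := k))
    (hvinv_r : conv (vF σ) (vinvF σ) = Coalgebra.counit (R := k))
    (hvinv_l : conv (vinvF σ) (vF σ) = Coalgebra.counit (R := k))
    (hS2u : ∀ h : H, 𝐒 (𝐒 h) = sw3 (uF σ) LinearMap.id (uinvF σ) h)
    (hS2v : ∀ h : H, 𝐒 (𝐒 h) = sw3 (vinvF σ) LinearMap.id (vF σ) h) :
    ∀ h : H, σ (h ⊗ₜ[k] (𝐒 a)) = σ (a ⊗ₜ[k] h) := by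
  intro h
  have ha : IsGroupLikeElem k a := by
    refine ⟨?_, ha_grp⟩
    have := rTensor_counit_comul (R := k) a
    rw [ha_grp, LinearMap.rTensor_tmul] at this
    have := congrArg (TensorProduct.lid k H) this
    rw [lid_tmul, lid_tmul] at this
    exact smul_left_injective k ha_ne this
  set αa := σ ∘ₗ (TensorProduct.mk k H H).flip (𝐒 a) with hαa
  have hv : vF σ = conv α.toLinearMap (conv (uF σ) αa) := by
    ext h
    rw [← sub_eq_zero, ← counit_lT (vF σ), ← apply_rT,
      ← counit_chiMap hSinv_r α.toLinearMap, ← map_sub]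
    refine counit_eq_zero_of_integral_mul_eq_zero hlam_ne ha_mod fun l => ?_
    rw [sub_mul, map_sub, ← hα, integral_lT_vF hlam_int ha_mod hσ2 hσ4, sub_self]
  have hu : conv (uF σ) α.toLinearMap = conv (vF σ) (σ ∘ₗ TensorProduct.mk k H H (𝐒 a)) := by
    ext h
    rw [← sub_eq_zero, ← counit_rT (conv (vF σ) _), ← apply_lT,
      ← counit_chiMap hSinv_r α.toLinearMap, ← map_sub]
    refine counit_eq_zero_of_integral_mul_eq_zero hlam_ne ha_mod fun l => ?_
    rw [sub_mul, map_sub, ← hα, integral_lT_uF hlam_int ha_mod rfl ha.mul_antipode_cancel hSinv_l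
      hσ1 (sigma_antipode_antipode hSinv_l hSinv_r hσ1 hσ2 hσ3l hσ3r) hσ4, sub_self]
  have hβ : conv (σ ∘ₗ TensorProduct.mk k H H (𝐒 a)) (σ ∘ₗ TensorProduct.mk k H H a) =
      Coalgebra.counit (R := k) := by
    ext h
    rw [← hσ1, ha.antipode_mul_cancel, hσ3r]
  have hα_inv : conv (α.toLinearMap ∘ₗ 𝐒) α.toLinearMap = Coalgebra.counit (R := k) := by
    ext h
    have := congrArg α (sum_antipode_mul_eq_smul (ℛ k h))
    simpa [conv_apply_sum] using this
  have key : conv α.toLinearMap (conv (uF σ) (σ ∘ₗ TensorProduct.mk k H H a)) =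
      conv α.toLinearMap (conv (uF σ) αa) := by
    rw [← hv, ← conv_assoc, ← algHom_conv_uF_comm α huinv_l hS2u, hu, conv_assoc, hβ, conv_counit]
  have key' := congrArg (fun f => conv (uinvF σ) (conv (α.toLinearMap ∘ₗ 𝐒) f)) key
  simp only [← conv_assoc _ α.toLinearMap, hα_inv, counit_conv] at key'
  simp only [← conv_assoc, huinv_l, counit_conv] at key'
  exact congrArg (fun f => f h) key'.symm
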